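/- arXiv:2205.07550 — 10 statements merged into one kernel-verified Lean document; each statement's English description precedes it below -/
import Mathlib

section
/- Every α-individually weakly stable matching is α-pair weakly stable, and every α-individually super stable matching is α-pair super stable. -/
variable {A : Type*}

/-- A matching given by a partial partner function: symmetric and irreflexive. -/
def IsMatching (M : A → Option A) : Prop :=
  (∀ a b : A, M a = some b → M b = some a) ∧ ∀ a : A, M a ≠ some a

/-- Agent `a` is happy in layer `i`: matched to an agent it approves. -/
def Happy {ℓ : ℕ} (T : A → Fin ℓ → Set A) (M : A → Option A) (i : Fin ℓ) (a : A) : Prop :=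
  ∃ b, M a = some b ∧ b ∈ T a i

/-- `{a, a'} ∉ M` blocks `M` in layer `i` under weak stability. -/
def BlocksWeak {ℓ : ℕ} (T : A → Fin ℓ → Set A) (M : A → Option A) (i : Fin ℓ)
    (a a' : A) : Prop :=
  a ≠ a' ∧ M a ≠ some a' ∧ a' ∈ T a i ∧ a ∈ T a' i ∧
    ¬ Happy T M i a ∧ ¬ Happy T M i a'

/-- `{a, a'} ∉ M` blocks `M` in layer `i` under strong stability. -/
def BlocksStrong {ℓ : ℕ} (T : A → Fin ℓ → Set A) (M : A → Option A) (i : Fin ℓ)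
    (a a' : A) : Prop :=
  a ≠ a' ∧ M a ≠ some a' ∧
    ((a' ∈ T a i ∧ ¬ Happy T M i a ∧ (a ∈ T a' i ∨ ¬ Happy T M i a')) ∨
     (a ∈ T a' i ∧ ¬ Happy T M i a' ∧ (a' ∈ T a i ∨ ¬ Happy T M i a)))

/-- `{a, a'} ∉ M` blocks `M` in layer `i` under super stability. -/
def BlocksSuper {ℓ : ℕ} (T : A → Fin ℓ → Set A) (M : A → Option A) (i : Fin ℓ)
    (a a' : A) : Prop :=
  a ≠ a' ∧ M a ≠ some a' ∧ (a' ∈ T a i ∨ ¬ Happy T M i a) ∧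
    (a ∈ T a' i ∨ ¬ Happy T M i a')

def WeakStable {ℓ : ℕ} (T : A → Fin ℓ → Set A) (M : A → Option A) (i : Fin ℓ) : Prop :=
  ∀ a a' : A, ¬ BlocksWeak T M i a a'

def StrongStable {ℓ : ℕ} (T : A → Fin ℓ → Set A) (M : A → Option A) (i : Fin ℓ) : Prop :=
  ∀ a a' : A, ¬ BlocksStrong T M i a a'

def SuperStable {ℓ : ℕ} (T : A → Fin ℓ → Set A) (M : A → Option A) (i : Fin ℓ) : Prop :=
  ∀ a a' : A, ¬ BlocksSuper T M i a a'

/-- `M` is α-globally weakly stable: `M` is weakly stable in at least `α` layers. -/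
def GlobalWeakStable {ℓ : ℕ} (T : A → Fin ℓ → Set A) (M : A → Option A) (α : ℕ) : Prop :=
  α ≤ Set.ncard {i : Fin ℓ | WeakStable T M i}

def GlobalStrongStable {ℓ : ℕ} (T : A → Fin ℓ → Set A) (M : A → Option A) (α : ℕ) : Prop :=
  α ≤ Set.ncard {i : Fin ℓ | StrongStable T M i}

def GlobalSuperStable {ℓ : ℕ} (T : A → Fin ℓ → Set A) (M : A → Option A) (α : ℕ) : Prop :=
  α ≤ Set.ncard {i : Fin ℓ | SuperStable T M i}

/-- `M` is α-pair weakly stable: every pair blocks in at most `ℓ - α` layers. -/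
def PairWeakStable {ℓ : ℕ} (T : A → Fin ℓ → Set A) (M : A → Option A) (α : ℕ) : Prop :=
  ∀ a a' : A, Set.ncard {i : Fin ℓ | BlocksWeak T M i a a'} ≤ ℓ - α

def PairStrongStable {ℓ : ℕ} (T : A → Fin ℓ → Set A) (M : A → Option A) (α : ℕ) : Prop :=
  ∀ a a' : A, Set.ncard {i : Fin ℓ | BlocksStrong T M i a a'} ≤ ℓ - α

def PairSuperStable {ℓ : ℕ} (T : A → Fin ℓ → Set A) (M : A → Option A) (α : ℕ) : Prop :=
  ∀ a a' : A, Set.ncard {i : Fin ℓ | BlocksSuper T M i a a'} ≤ ℓ - α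

/-- `M` is α-individually weakly stable. -/
def IndWeakStable {ℓ : ℕ} (T : A → Fin ℓ → Set A) (M : A → Option A) (α : ℕ) : Prop :=
  ∀ a a' : A, a ≠ a' → M a ≠ some a' →
    (α ≤ Set.ncard {i : Fin ℓ | a' ∉ T a i ∨ Happy T M i a}) ∨
    (α ≤ Set.ncard {i : Fin ℓ | a ∉ T a' i ∨ Happy T M i a'})

/-- `M` is α-individually super stable. -/
def IndSuperStable {ℓ : ℕ} (T : A → Fin ℓ → Set A) (M : A → Option A) (α : ℕ) : Prop :=
  ∀ a a' : A, a ≠ a' → M a ≠ some a' →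
    (α ≤ Set.ncard {i : Fin ℓ | a' ∉ T a i ∧ Happy T M i a}) ∨
    (α ≤ Set.ncard {i : Fin ℓ | a ∉ T a' i ∧ Happy T M i a'})

theorem ncard_le_of_disjoint_layers {ℓ α : ℕ} {S B : Set (Fin ℓ)} (h : α ≤ S.ncard)
    (hd : ∀ i ∈ B, i ∉ S) : B.ncard ≤ ℓ - α := by
  have h1 : B.ncard ≤ Sᶜ.ncard := Set.ncard_le_ncard (fun i hi => hd i hi) (Set.toFinite _)
  have h2 := Set.ncard_add_ncard_compl S
  rw [Nat.card_fin] at h2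
  omega

theorem individual_implies_pair {ℓ α : ℕ} (hα : 1 ≤ α) (hαℓ : α ≤ ℓ)
    (T : A → Fin ℓ → Set A) (hT : ∀ (a : A) (i : Fin ℓ), a ∉ T a i)
    (M : A → Option A) (hM : IsMatching M) :
    (IndWeakStable T M α → PairWeakStable T M α) ∧
    (IndSuperStable T M α → PairSuperStable T M α) := by
  constructor
  · intro h a a'
    by_cases hb : a ≠ a' ∧ M a ≠ some a'
    · rcases h a a' hb.1 hb.2 with h1 | h1 <;> refine ncard_le_of_disjoint_layers h1 ?_ <;>
        simp only [BlocksWeak, Set.mem_setOf_eq] <;> tauto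
    · have : {i : Fin ℓ | BlocksWeak T M i a a'} = ∅ := by
        ext i
        simp only [BlocksWeak, Set.mem_setOf_eq, Set.mem_empty_iff_false]
        tauto
      simp [this]
  · intro h a a'
    by_cases hb : a ≠ a' ∧ M a ≠ some a'
    · rcases h a a' hb.1 hb.2 with h1 | h1 <;> refine ncard_le_of_disjoint_layers h1 ?_ <;>
        simp only [BlocksSuper, Set.mem_setOf_eq] <;> tauto
    · have : {i : Fin ℓ | BlocksSuper T M i a a'} = ∅ := by
        ext i
        simp only [BlocksSuper, Set.mem_setOf_eq, Set.mem_empty_iff_false]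
        tauto
      simp [this]
end

section
/- Suppose approvals are symmetric. A matching M is strongly stable in layer i if and only if every agent a that has at least one neighbor in G_i is matched in M and satisfies {a, M(a)} ∈ E_i. -/
variable {A : Type*}

theorem strongStable_iff_all_covered {ℓ : ℕ} (T : A → Fin ℓ → Set A)
    (hT : ∀ (a : A) (i : Fin ℓ), a ∉ T a i)
    (hsym : ∀ (i : Fin ℓ) (a a' : A), a' ∈ T a i ↔ a ∈ T a' i)
    (M : A → Option A) (hM : IsMatching M) (i : Fin ℓ) :
    StrongStable T M i ↔
      ∀ a : A, (∃ b : A, b ∈ T a i ∧ a ∈ T b i) →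
        ∃ b : A, M a = some b ∧ b ∈ T a i ∧ a ∈ T b i := by
  constructor
  · rintro h a ⟨b, hb, hb'⟩
    by_contra hn
    have hu : ¬ Happy T M i a := by
      rintro ⟨c, hc, hc'⟩
      exact hn ⟨c, hc, hc', (hsym i a c).1 hc'⟩
    refine h a b ⟨?_, ?_, Or.inl ⟨hb, hu, Or.inl hb'⟩⟩
    · rintro rfl
      exact hT _ _ hb
    · intro hm
      exact hn ⟨b, hm, hb, hb'⟩
  · rintro h a b ⟨-, -, ⟨hb, hu, -⟩ | ⟨hb, hu, -⟩⟩
    · obtain ⟨c, hc, hc', -⟩ := h a ⟨b, hb, (hsym i a b).1 hb⟩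
      exact hu ⟨c, hc, hc'⟩
    · obtain ⟨c, hc, hc', -⟩ := h b ⟨a, hb, (hsym i b a).1 hb⟩
      exact hu ⟨c, hc, hc'⟩
end

section
/- Let 1 ≤ α ≤ ⌈ℓ/2⌉ (approvals may be asymmetric). Let G be the undirected graph on A with an edge {a,a'} if and only if there are at least ℓ−α+1 layers in which a approves a' and at least ℓ−α+1 layers in which a' approves a. Then every maximal matching of G is an α-individually weakly stable matching (and hence also α-pair weakly stable). In particular, for every α ≤ ⌈ℓ/2⌉ an α-individually weakly stable matching always exists. -/
variable {A : Type*}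

theorem exists_maximal_matching_aux [Fintype A] [DecidableEq A] (R : A → A → Prop)
    (hR : ∀ a b, R a b → R b a) :
    ∃ M : A → Option A, IsMatching M ∧ (∀ a b, M a = some b → R a b) ∧
      ∀ a a', a ≠ a' → R a a' → (M a).isSome ∨ (M a').isSome := by
  classical
  let S : Set (A → Option A) := {M | IsMatching M ∧ ∀ a b, M a = some b → R a b}
  have hne : S.Nonempty := ⟨fun _ => none, ⟨by simp [IsMatching], by simp⟩⟩
  obtain ⟨M, ⟨hM, hMR⟩, hmax⟩ := Set.exists_max_image S
    (fun M => (Finset.univ.filter (fun a => (M a).isSome)).card) (Set.toFinite S) hne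
  refine ⟨M, hM, hMR, ?_⟩
  intro a a' hne hr
  by_contra hcon
  push Not at hcon
  obtain ⟨h1, h2⟩ := hcon
  have h1 : M a = none := by simpa using h1
  have h2 : M a' = none := by simpa using h2
  let N : A → Option A := fun x => if x = a then some a' else if x = a' then some a else M x
  have hN : N ∈ S := by
    obtain ⟨hs, hi⟩ := hM
    refine ⟨⟨?_, ?_⟩, ?_⟩
    · intro x y hxy
      have := hs x y
      simp only [N] at hxy ⊢
      grind
    · intro x hx
      have := hi x
      simp only [N] at hx
      grind
    · intro x y hxy
      have := hMR x y
      have := hR a a' hr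
      simp only [N] at hxy
      grind
  have hlt : (Finset.univ.filter (fun x => (M x).isSome)).card <
      (Finset.univ.filter (fun x => (N x).isSome)).card := by
    apply Finset.card_lt_card
    rw [Finset.ssubset_iff_of_subset]
    · exact ⟨a, by simp [N], by simp [h1]⟩
    · intro x hx
      simp only [Finset.mem_filter, Finset.mem_univ, true_and, N] at hx ⊢
      grind
  exact absurd (hmax N hN) (not_le.mpr hlt)

theorem ncard_disjoint_aux {ℓ : ℕ} (s t : Set (Fin ℓ)) (h : Disjoint s t) :
    s.ncard + t.ncard ≤ ℓ := by
  rw [← Set.ncard_union_eq h (Set.toFinite s) (Set.toFinite t)]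
  simpa using Set.ncard_le_card (s ∪ t)

theorem maximal_matching_ind_weakStable {ℓ α : ℕ} (hα1 : 1 ≤ α)
    (hα : α ≤ (ℓ + 1) / 2) [Fintype A] [DecidableEq A]
    (T : A → Fin ℓ → Set A) (hT : ∀ (a : A) (i : Fin ℓ), a ∉ T a i) :
    (∀ M : A → Option A, IsMatching M →
      (∀ a b : A, M a = some b →
        (ℓ - α + 1 ≤ Set.ncard {i : Fin ℓ | b ∈ T a i} ∧
         ℓ - α + 1 ≤ Set.ncard {i : Fin ℓ | a ∈ T b i})) →
      (∀ a a' : A, a ≠ a' →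
        ℓ - α + 1 ≤ Set.ncard {i : Fin ℓ | a' ∈ T a i} →
        ℓ - α + 1 ≤ Set.ncard {i : Fin ℓ | a ∈ T a' i} →
        (M a).isSome ∨ (M a').isSome) →
      IndWeakStable T M α ∧ PairWeakStable T M α) ∧
    (∃ M : A → Option A, IsMatching M ∧ IndWeakStable T M α) := by
  have hle : α ≤ ℓ - α + 1 := by omega
  have main : ∀ M : A → Option A, IsMatching M →
      (∀ a b : A, M a = some b →
        (ℓ - α + 1 ≤ Set.ncard {i : Fin ℓ | b ∈ T a i} ∧
         ℓ - α + 1 ≤ Set.ncard {i : Fin ℓ | a ∈ T b i})) →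
      (∀ a a' : A, a ≠ a' →
        ℓ - α + 1 ≤ Set.ncard {i : Fin ℓ | a' ∈ T a i} →
        ℓ - α + 1 ≤ Set.ncard {i : Fin ℓ | a ∈ T a' i} →
        (M a).isSome ∨ (M a').isSome) →
      IndWeakStable T M α ∧ PairWeakStable T M α := by
    intro M hM hE hmax
    have hhappy : ∀ a c : A, (M a).isSome →
        α ≤ Set.ncard {i : Fin ℓ | c ∉ T a i ∨ Happy T M i a} := by
      intro a c ha
      obtain ⟨b, hb⟩ := Option.isSome_iff_exists.mp ha
      refine hle.trans ((hE a b hb).1.trans (Set.ncard_le_ncard ?_ (Set.toFinite _)))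
      intro i hi
      exact Or.inr ⟨b, hb, hi⟩
    have hcompl : ∀ a c : A, ¬ (ℓ - α + 1 ≤ Set.ncard {i : Fin ℓ | c ∈ T a i}) →
        α ≤ Set.ncard {i : Fin ℓ | c ∉ T a i ∨ Happy T M i a} := by
      intro a c h
      have h1 := Set.ncard_add_ncard_compl {i : Fin ℓ | c ∈ T a i}
      rw [Nat.card_fin] at h1
      have h2 : Set.ncard {i : Fin ℓ | c ∈ T a i}ᶜ ≤
          Set.ncard {i : Fin ℓ | c ∉ T a i ∨ Happy T M i a} :=
        Set.ncard_le_ncard (fun i hi => Or.inl hi) (Set.toFinite _)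
      omega
    have hind : IndWeakStable T M α := by
      intro a a' hne _
      by_cases h1 : ℓ - α + 1 ≤ Set.ncard {i : Fin ℓ | a' ∈ T a i}
      · by_cases h2 : ℓ - α + 1 ≤ Set.ncard {i : Fin ℓ | a ∈ T a' i}
        · rcases hmax a a' hne h1 h2 with h | h
          · exact Or.inl (hhappy _ _ h)
          · exact Or.inr (hhappy _ _ h)
        · exact Or.inr (hcompl _ _ h2)
      · exact Or.inl (hcompl _ _ h1)
    refine ⟨hind, ?_⟩
    intro a a'
    by_cases hc : a ≠ a' ∧ M a ≠ some a'
    · rcases hind a a' hc.1 hc.2 with h | h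
      · have := ncard_disjoint_aux {i : Fin ℓ | BlocksWeak T M i a a'}
          {i : Fin ℓ | a' ∉ T a i ∨ Happy T M i a} (by
          rw [Set.disjoint_left]
          rintro i ⟨_, _, h1, h2, h3, h4⟩ (h5 : a' ∉ T a i ∨ Happy T M i a)
          tauto)
        omega
      · have := ncard_disjoint_aux {i : Fin ℓ | BlocksWeak T M i a a'}
          {i : Fin ℓ | a ∉ T a' i ∨ Happy T M i a'} (by
          rw [Set.disjoint_left]
          rintro i ⟨_, _, h1, h2, h3, h4⟩ (h5 : a ∉ T a' i ∨ Happy T M i a')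
          tauto)
        omega
    · have : {i : Fin ℓ | BlocksWeak T M i a a'} = ∅ := by
        ext i
        simp only [Set.mem_ofPred_eq, Set.mem_empty_iff_false, iff_false]
        rintro ⟨h1, h2, _⟩
        exact hc ⟨h1, h2⟩
      rw [this]
      simp
  refine ⟨main, ?_⟩
  obtain ⟨M, hM, hE, hmax⟩ := exists_maximal_matching_aux
    (fun a b : A => ℓ - α + 1 ≤ Set.ncard {i : Fin ℓ | b ∈ T a i} ∧
      ℓ - α + 1 ≤ Set.ncard {i : Fin ℓ | a ∈ T b i}) (fun a b h => ⟨h.2, h.1⟩)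
  exact ⟨M, hM, (main M hM hE (fun a a' hne h1 h2 => hmax a a' hne ⟨h1, h2⟩)).1⟩
end

section
/- Suppose approvals are symmetric and the number n of agents is even. For each layer i let E_i' = E_i ∪ {{a,a'} : in layer i neither a nor a' approves any agent}, and let H be the undirected graph on A with edge set ⋂_{i∈{1,…,ℓ}} E_i'. Then: (1) every perfect matching of H is all-layers strongly stable; and (2) an all-layers strongly stable matching exists if and only if H admits a perfect matching. -/
variable {A : Type*}

/-- Edge of the graph `H = ⋂ᵢ E_i'`: in each layer `i` either the two agents mutually
approve each other, or neither of them approves any agent in layer `i`. -/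
def HEdge {ℓ : ℕ} (T : A → Fin ℓ → Set A) (a a' : A) : Prop :=
  a ≠ a' ∧ ∀ i : Fin ℓ, a' ∈ T a i ∨ (T a i = ∅ ∧ T a' i = ∅)

theorem exists_pairing {U : Type*} [Fintype U] (h : Even (Fintype.card U)) :
    ∃ g : U → U, (∀ u, g (g u) = u) ∧ ∀ u, g u ≠ u := by
  obtain ⟨k, hk⟩ := h
  have e : U ≃ Fin k ⊕ Fin k := Fintype.equivOfCardEq (by simp [hk])
  refine ⟨fun u => e.symm (Sum.swap (e u)), fun u => by simp, fun u hu => ?_⟩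
  have h2 : Sum.swap (e u) = e u := by
    rw [Equiv.symm_apply_eq] at hu
    exact hu
  rcases h3 : e u with x | x <;> simp [h3] at h2

theorem even_unmatched [Fintype A] [DecidableEq A] (heven : Even (Fintype.card A))
    (M : A → Option A) (hM : IsMatching M) :
    Even (Fintype.card {a // M a = none}) := by
  have hinv : Function.Involutive (fun a => (M a).getD a) := by
    intro a
    rcases h : M a with _ | b
    · simp [h]
    · simp [h, hM.1 a b h]
  have hp : (hinv.toPerm) ^ 2 ^ 1 = 1 := by
    ext a
    simpa [pow_two] using hinv a
  haveI : Fact (Nat.Prime 2) := ⟨Nat.prime_two⟩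
  have key := Equiv.Perm.card_fixedPoints_modEq (f := (fun a => (M a).getD a))
    (p := 2) (n := 1) (by
      funext a
      exact hinv a)
  have hc : Fintype.card {a // M a = none} =
      Fintype.card (Function.fixedPoints (fun a => (M a).getD a)) := by
    apply Fintype.card_congr
    refine Equiv.subtypeEquivRight fun a => ?_
    rcases h : M a with _ | b
    · simp [Function.mem_fixedPoints, Function.IsFixedPt, h]
    · have : b ≠ a := fun hb => hM.2 a (hb ▸ h)
      simp [Function.mem_fixedPoints, Function.IsFixedPt, h, this]
  rw [hc]
  rw [Nat.even_iff] at heven ⊢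
  unfold Nat.ModEq at key
  omega

theorem allLayersStrong_iff_perfectMatching {ℓ : ℕ} (hℓ : 1 ≤ ℓ)
    [Fintype A] [DecidableEq A]
    (heven : Even (Fintype.card A))
    (T : A → Fin ℓ → Set A) (hT : ∀ (a : A) (i : Fin ℓ), a ∉ T a i)
    (hsym : ∀ (i : Fin ℓ) (a a' : A), a' ∈ T a i ↔ a ∈ T a' i) :
    (∀ M : A → Option A, IsMatching M →
      (∀ a : A, ∃ b : A, M a = some b ∧ HEdge T a b) →
      ∀ i : Fin ℓ, StrongStable T M i) ∧
    ((∃ M : A → Option A, IsMatching M ∧ ∀ i : Fin ℓ, StrongStable T M i) ↔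
     (∃ M : A → Option A, IsMatching M ∧ ∀ a : A, ∃ b : A, M a = some b ∧ HEdge T a b)) := by
  have part1 : ∀ M : A → Option A, IsMatching M →
      (∀ a : A, ∃ b : A, M a = some b ∧ HEdge T a b) →
      ∀ i : Fin ℓ, StrongStable T M i := by
    intro M hM hH i a a' hb
    have hap : ∀ x y, y ∈ T x i → Happy T M i x := by
      intro x y hy
      obtain ⟨b, hb, _, hE⟩ := hH x
      rcases hE i with h | h
      · exact ⟨b, hb, h⟩
      · rw [h.1] at hy
        exact absurd hy (Set.notMem_empty y)
    rcases hb.2.2 with h | h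
    · exact h.2.1 (hap _ _ h.1)
    · exact h.2.1 (hap _ _ h.1)
  refine ⟨part1, ?_, fun ⟨M, hM, hH⟩ => ⟨M, hM, part1 M hM hH⟩⟩
  rintro ⟨M, hM, hS⟩
  have hap : ∀ i x y, y ∈ T x i → Happy T M i x := by
    intro i x y hy
    by_contra hn
    refine hS i x y ⟨?_, ?_, Or.inl ⟨hy, hn, Or.inl ((hsym i x y).1 hy)⟩⟩
    · rintro rfl
      exact hT x i hy
    · exact fun h => hn ⟨y, h, hy⟩
  have hempty : ∀ a, M a = none → ∀ i, T a i = ∅ := by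
    intro a ha i
    refine Set.eq_empty_iff_forall_notMem.2 fun y hy => ?_
    obtain ⟨b, hb, _⟩ := hap i a y hy
    simp [ha] at hb
  obtain ⟨g, hg, hg'⟩ := exists_pairing (even_unmatched heven M hM)
  refine ⟨fun a => if h : M a = none then some (g ⟨a, h⟩).1 else M a, ⟨?_, ?_⟩, ?_⟩
  · intro a b hab
    by_cases h : M a = none
    · simp only [h, dite_true, Option.some.injEq] at hab
      subst hab
      simp [(g ⟨a, h⟩).2, hg]
    · simp only [h, dite_false] at hab
      simp [hM.1 a b hab]
  · intro a hab
    by_cases h : M a = none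
    · simp only [h, dite_true, Option.some.injEq] at hab
      exact hg' ⟨a, h⟩ (Subtype.ext hab)
    · simp only [h, dite_false] at hab
      exact hM.2 a hab
  · intro a
    by_cases h : M a = none
    · refine ⟨(g ⟨a, h⟩).1, by simp [h], fun e => hg' ⟨a, h⟩ (Subtype.ext e.symm), fun i => ?_⟩
      exact Or.inr ⟨hempty a h i, hempty _ (g ⟨a, h⟩).2 i⟩
    · obtain ⟨b, hb⟩ := Option.ne_none_iff_exists'.1 h
      refine ⟨b, by simp [hb], fun e => hM.2 a (by rw [hb, e]), fun i => ?_⟩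
      by_cases hba : b ∈ T a i
      · exact Or.inl hba
      · refine Or.inr ⟨Set.eq_empty_iff_forall_notMem.2 fun y hy => ?_,
          Set.eq_empty_iff_forall_notMem.2 fun y hy => ?_⟩
        · obtain ⟨c, hc, hc'⟩ := hap i a y hy
          rw [hb, Option.some.injEq] at hc
          exact hba (hc ▸ hc')
        · obtain ⟨c, hc, hc'⟩ := hap i b y hy
          rw [hM.1 a b hb, Option.some.injEq] at hc
          subst hc
          exact hba ((hsym i a b).2 hc')
end

section
/- Suppose approvals are symmetric and the number n of agents is odd. If an all-layers strongly stable matching exists, then there is an agent that approves no agent in any layer. Equivalently, if every agent approves at least one agent in at least one layer, then no all-layers strongly stable matching exists. -/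
variable {A : Type*}

theorem odd_allLayersStrong_implies_isolated_agent {ℓ : ℕ} (hℓ : 1 ≤ ℓ)
    [Fintype A] [DecidableEq A]
    (hodd : Odd (Fintype.card A))
    (T : A → Fin ℓ → Set A) (hT : ∀ (a : A) (i : Fin ℓ), a ∉ T a i)
    (hsym : ∀ (i : Fin ℓ) (a a' : A), a' ∈ T a i ↔ a ∈ T a' i)
    (M : A → Option A) (hM : IsMatching M)
    (hstable : ∀ i : Fin ℓ, StrongStable T M i) :
    ∃ a : A, ∀ i : Fin ℓ, T a i = ∅ := by
  have hf : Function.Involutive (fun a => (M a).getD a) := by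
    intro a
    cases h : M a with
    | none => simp [h]
    | some b => simp [h, hM.1 a b h]
  obtain ⟨a, ha⟩ : ∃ a : A, (hf.toPerm _ : Equiv.Perm A) a = a := by
    have : Fact (Nat.Prime 2) := ⟨Nat.prime_two⟩
    refine Equiv.Perm.exists_fixed_point_of_prime (α := A) (p := 2) (n := 1) ?_ ?_
    · exact hodd.not_two_dvd_nat
    · ext x
      simpa [pow_two] using hf x
  have hn : M a = none := by
    cases h : M a with
    | none => rfl
    | some b =>
      have hb : b = a := by simpa [h] using ha
      exact absurd (hb ▸ h) (hM.2 a)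
  refine ⟨a, fun i => ?_⟩
  ext b
  simp only [Set.mem_empty_iff_false, iff_false]
  intro hb
  refine hstable i a b ⟨?_, by simp [hn], Or.inl ⟨hb, ?_, Or.inl ((hsym i a b).1 hb)⟩⟩
  · rintro rfl
    exact hT _ i hb
  · rintro ⟨c, hc, -⟩
    simp [hn] at hc
end

section
/- Suppose approvals are symmetric and α > ℓ/2. In every α-individually super stable matching M, every edge {u,v} of the graph G_{ℓ−α+1} satisfies {u,v} ∈ M. Consequently, if some agent has degree at least two in G_{ℓ−α+1}, then no α-individually super stable matching exists. -/
variable {A : Type*}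

/-- Edge of the graph `G_m`: `a ≠ a'` mutually approve each other in at least `m` layers. -/
def MutualEdge {ℓ : ℕ} (T : A → Fin ℓ → Set A) (m : ℕ) (a a' : A) : Prop :=
  a ≠ a' ∧ m ≤ Set.ncard {i : Fin ℓ | a' ∈ T a i ∧ a ∈ T a' i}

theorem indSuper_forces_frequent_mutual_edges {ℓ α : ℕ} (hα : ℓ < 2 * α)
    (T : A → Fin ℓ → Set A) (hT : ∀ (a : A) (i : Fin ℓ), a ∉ T a i)
    (hsym : ∀ (i : Fin ℓ) (a a' : A), a' ∈ T a i ↔ a ∈ T a' i) :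
    (∀ M : A → Option A, IsMatching M → IndSuperStable T M α →
      ∀ u v : A, MutualEdge T (ℓ - α + 1) u v → M u = some v) ∧
    (∀ u v w : A, v ≠ w →
      MutualEdge T (ℓ - α + 1) u v → MutualEdge T (ℓ - α + 1) u w →
      ¬ ∃ M : A → Option A, IsMatching M ∧ IndSuperStable T M α) := by
  have key : ∀ S R : Set (Fin ℓ), (∀ i, i ∈ S → i ∈ R → False) →
      α ≤ S.ncard → ℓ - α + 1 ≤ R.ncard → False := by
    intro S R hd h1 h2
    have hdis : Disjoint S R := Set.disjoint_left.mpr fun i hi hj => hd i hi hj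
    have hu := Set.ncard_union_eq hdis (Set.toFinite S) (Set.toFinite R)
    have hle : (S ∪ R).ncard ≤ ℓ := by
      have := Set.ncard_le_card (S ∪ R)
      simpa using this
    omega
  have main : ∀ M : A → Option A, IsMatching M → IndSuperStable T M α →
      ∀ u v : A, MutualEdge T (ℓ - α + 1) u v → M u = some v := by
    intro M _ hS u v huv
    by_contra hne
    rcases hS u v huv.1 hne with h | h
    · exact key _ _ (fun i hi hj => hi.1 hj.1) h huv.2
    · exact key _ _ (fun i hi hj => hi.1 hj.2) h huv.2
  refine ⟨main, ?_⟩
  rintro u v w hvw huv huw ⟨M, hM, hS⟩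
  have h1 := main M hM hS u v huv
  have h2 := main M hM hS u w huw
  exact hvw (Option.some.inj (h1.symm.trans h2))
end

section
/- Suppose approvals are symmetric and α > ℓ/2. If at least three agents have degree zero in the graph G_{ℓ−α+1}, then no α-individually super stable matching exists. -/
variable {A : Type*}

theorem isolated_few_happy {ℓ α : ℕ} (hα : ℓ < 2 * α)
    (T : A → Fin ℓ → Set A)
    (hsym : ∀ (i : Fin ℓ) (a a' : A), a' ∈ T a i ↔ a ∈ T a' i)
    (M : A → Option A) (hM : IsMatching M) (u x : A)
    (hu : ∀ x : A, ¬ MutualEdge T (ℓ - α + 1) u x) :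
    ¬ α ≤ Set.ncard {i : Fin ℓ | x ∉ T u i ∧ Happy T M i u} := by
  intro h
  rcases hMu : M u with _ | b
  · have : {i : Fin ℓ | x ∉ T u i ∧ Happy T M i u} = ∅ := by
      ext i
      simp [Happy, hMu]
    rw [this, Set.ncard_empty] at h
    omega
  · have hub : u ≠ b := by
      rintro rfl
      exact hM.2 _ hMu
    have hsub : {i : Fin ℓ | x ∉ T u i ∧ Happy T M i u} ⊆
        {i : Fin ℓ | b ∈ T u i ∧ u ∈ T b i} := by
      rintro i ⟨_, c, hc, hct⟩
      rw [hMu] at hc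
      cases hc
      exact ⟨hct, (hsym i u b).1 hct⟩
    have hle := Set.ncard_le_ncard hsub (Set.toFinite _)
    exact hu b ⟨hub, by omega⟩

theorem three_isolated_no_indSuper {ℓ α : ℕ} (hα : ℓ < 2 * α)
    (T : A → Fin ℓ → Set A) (hT : ∀ (a : A) (i : Fin ℓ), a ∉ T a i)
    (hsym : ∀ (i : Fin ℓ) (a a' : A), a' ∈ T a i ↔ a ∈ T a' i)
    (u v w : A) (huv : u ≠ v) (huw : u ≠ w) (hvw : v ≠ w)
    (hu : ∀ x : A, ¬ MutualEdge T (ℓ - α + 1) u x)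
    (hv : ∀ x : A, ¬ MutualEdge T (ℓ - α + 1) v x)
    (hw : ∀ x : A, ¬ MutualEdge T (ℓ - α + 1) w x) :
    ¬ ∃ M : A → Option A, IsMatching M ∧ IndSuperStable T M α := by
  rintro ⟨M, hM, hS⟩
  have key := isolated_few_happy hα T hsym M hM
  by_cases h : M u = some v
  · have h2 : M u ≠ some w := by
      rw [h]
      simpa using hvw
    rcases hS u w huw h2 with h3 | h3
    · exact key u w hu h3
    · exact key w u hw h3
  · rcases hS u v huv h with h3 | h3
    · exact key u v hu h3
    · exact key v u hv h3
end

section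
/- Let ℓ ≥ 2 and suppose the ℓ layers take only two distinct values: there are ⌈ℓ/2⌉ layers in which every agent's approval set equals its approval set in layer 1, and ⌊ℓ/2⌋ layers in which every agent's approval set equals its approval set in layer 2. Let α > ⌈ℓ/2⌉. Then every α-pair weakly stable matching is weakly stable in all ℓ layers (i.e., all-layers weakly stable), and conversely every all-layers weakly stable matching is α-pair weakly stable. -/
variable {A : Type*}

theorem two_valued_layers_pair_iff_allLayers {ℓ α : ℕ} (hℓ : 2 ≤ ℓ)
    (hα : (ℓ + 1) / 2 < α)
    (T : A → Fin ℓ → Set A) (hT : ∀ (a : A) (i : Fin ℓ), a ∉ T a i)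
    (S : Finset (Fin ℓ)) (hScard : S.card = (ℓ + 1) / 2)
    (hS1 : ∀ i ∈ S, ∀ a : A, T a i = T a ⟨0, by omega⟩)
    (hS2 : ∀ i ∉ S, ∀ a : A, T a i = T a ⟨1, by omega⟩)
    (M : A → Option A) (hM : IsMatching M) :
    PairWeakStable T M α ↔ ∀ i : Fin ℓ, WeakStable T M i := by
  have key : ∀ i j : Fin ℓ, (∀ a, T a i = T a j) → ∀ a a' : A,
      BlocksWeak T M i a a' → BlocksWeak T M j a a' := by
    intro i j h a a' hb
    simpa only [BlocksWeak, Happy, h] using hb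
  constructor
  · intro hP i a a' hb
    have h1 := hP a a'
    by_cases hi : i ∈ S
    · have hsub : (S : Set (Fin ℓ)) ⊆ {j : Fin ℓ | BlocksWeak T M j a a'} := by
        intro j hj
        exact key i j (fun x => (hS1 i hi x).trans (hS1 j hj x).symm) a a' hb
      have h2 := Set.ncard_le_ncard hsub (Set.toFinite _)
      rw [Set.ncard_coe_finset] at h2
      omega
    · have hsub : ((Sᶜ : Finset (Fin ℓ)) : Set (Fin ℓ)) ⊆
          {j : Fin ℓ | BlocksWeak T M j a a'} := by
        intro j hj
        have hj' : j ∉ S := by simpa using hj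
        exact key i j (fun x => (hS2 i hi x).trans (hS2 j hj' x).symm) a a' hb
      have h2 := Set.ncard_le_ncard hsub (Set.toFinite _)
      rw [Set.ncard_coe_finset, Finset.card_compl, Fintype.card_fin] at h2
      omega
  · intro h a a'
    have he : {i : Fin ℓ | BlocksWeak T M i a a'} = ∅ := by
      ext i
      simpa using h i a a'
    rw [he, Set.ncard_empty]
    exact Nat.zero_le _
end

section
/- Let G = (V,E) be a graph with V = {v_1,…,v_ν} and let k ∈ ℕ. Construct the following multilayer instance with symmetric approvals: the agent set is A = {e^1, e^2, e^3, e^4 : e ∈ E} and there are ℓ = ν layers; in layer i, for each edge e = {v_i, v_j} ∈ E with i < j, agents e^1 and e^2 mutually approve each other and agents e^3 and e^4 mutually approve each other; for each edge e = {v_i, v_j} ∈ E with j < i, agents e^1 and e^3 mutually approve each other and agents e^2 and e^4 mutually approve each other; there are no other approvals. Then G has an independent set of size k if and only if the constructed instance admits a k-globally strongly stable matching. -/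
variable {A : Type*}

theorem independentSet_iff_globallyStrongStable {ν : ℕ} (G : SimpleGraph (Fin ν)) (k : ℕ)
    (T : ↥G.edgeSet × Fin 4 → Fin ν → Set (↥G.edgeSet × Fin 4))
    (hT : ∀ (x y : ↥G.edgeSet × Fin 4) (i : Fin ν), y ∈ T x i ↔
      (y.1 = x.1 ∧ ∃ j : Fin ν, (x.1 : Sym2 (Fin ν)) = s(i, j) ∧
        ((i < j ∧ ((x.2 = 0 ∧ y.2 = 1) ∨ (x.2 = 1 ∧ y.2 = 0) ∨
                   (x.2 = 2 ∧ y.2 = 3) ∨ (x.2 = 3 ∧ y.2 = 2))) ∨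
         (j < i ∧ ((x.2 = 0 ∧ y.2 = 2) ∨ (x.2 = 2 ∧ y.2 = 0) ∨
                   (x.2 = 1 ∧ y.2 = 3) ∨ (x.2 = 3 ∧ y.2 = 1)))))) :
    (∃ s : Finset (Fin ν), s.card = k ∧ ∀ u ∈ s, ∀ v ∈ s, ¬ G.Adj u v) ↔
    (∃ M : ↥G.edgeSet × Fin 4 → Option (↥G.edgeSet × Fin 4), IsMatching M ∧
      k ≤ Set.ncard {i : Fin ν | StrongStable T M i}) := by
  classical
  constructor
  · rintro ⟨s, hs, hind⟩
    let σ : Fin 4 → Fin 4 := ![1, 0, 3, 2]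
    let τ : Fin 4 → Fin 4 := ![2, 3, 0, 1]
    have hσ : ∀ c, σ (σ c) = c ∧ σ c ≠ c := by decide
    have hτ : ∀ c, τ (τ c) = c ∧ τ c ≠ c := by decide
    let p : ↥G.edgeSet → Prop := fun e => ∃ i ∈ s, ∃ j, (e : Sym2 (Fin ν)) = s(i, j) ∧ i < j
    let M : ↥G.edgeSet × Fin 4 → Option (↥G.edgeSet × Fin 4) :=
      fun x => some (x.1, if p x.1 then σ x.2 else τ x.2)
    refine ⟨M, ⟨?_, ?_⟩, ?_⟩
    · rintro ⟨e, c⟩ b hb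
      simp only [M, Option.some.injEq] at hb
      subst hb
      by_cases hp : p e
      · simp [M, hp, (hσ c).1]
      · simp [M, hp, (hτ c).1]
    · rintro ⟨e, c⟩ hb
      by_cases hp : p e
      · simp [M, hp, (hσ c).2] at hb
      · simp [M, hp, (hτ c).2] at hb
    · rw [← hs, ← Set.ncard_coe_finset]
      refine Set.ncard_le_ncard ?_ (Set.toFinite _)
      intro i hi
      have hi : i ∈ s := hi
      have key : ∀ a b, b ∈ T a i → Happy T M i a := by
        rintro ⟨e, c⟩ b hb
        rw [hT] at hb
        obtain ⟨-, j, hej, h⟩ := hb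
        simp only at hej h
        refine ⟨_, rfl, ?_⟩
        rw [hT]
        refine ⟨rfl, j, hej, ?_⟩
        rcases h with ⟨hij, -⟩ | ⟨hij, -⟩
        · left
          have hp : p e := ⟨i, hi, j, hej, hij⟩
          refine ⟨hij, ?_⟩
          simp only [hp, if_true]
          clear * -
          revert c
          decide
        · right
          have hp : ¬ p e := by
            rintro ⟨i', hi', j', he', hlt⟩
            have hadj : G.Adj i j := by
              have := e.2
              rw [hej] at this
              exact this
            rw [hej] at he'
            rcases Sym2.eq_iff.1 he' with ⟨h1, h2⟩ | ⟨h1, h2⟩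
            · subst h1 h2
              exact absurd hij (lt_asymm hlt)
            · subst h1 h2
              exact hind _ hi _ hi' hadj
          refine ⟨hij, ?_⟩
          simp only [hp, if_false]
          clear * -
          revert c
          decide
      rintro a a' ⟨-, -, ⟨h, hn, -⟩ | ⟨h, hn, -⟩⟩
      · exact hn (key _ _ h)
      · exact hn (key _ _ h)
  · rintro ⟨M, hM, hk⟩
    have main : ∀ u v, u < v → G.Adj u v → StrongStable T M u → StrongStable T M v → False := by
      intro u v huv hadj hu hv
      let e : ↥G.edgeSet := ⟨s(u, v), hadj⟩
      have h1 : M (e, 0) = some (e, 1) := by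
        by_contra hne
        refine hu (e, 0) (e, 1) ⟨by simp, hne, Or.inl ⟨?_, ?_, Or.inl ?_⟩⟩
        · rw [hT]
          exact ⟨rfl, v, rfl, Or.inl ⟨huv, by simp⟩⟩
        · rintro ⟨⟨f, c⟩, hb, hbT⟩
          rw [hT] at hbT
          obtain ⟨hf, j, hej, h⟩ := hbT
          have hj : v = j := by simpa [e, huv.ne, huv.ne'] using hej
          subst hj
          simp only at hf h
          subst hf
          have hc : c = 1 := by simpa [huv, huv.not_gt] using h
          subst hc
          exact hne hb
        · rw [hT]
          exact ⟨rfl, v, rfl, Or.inl ⟨huv, by simp⟩⟩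
      have h2 : M (e, 0) = some (e, 2) := by
        by_contra hne
        refine hv (e, 0) (e, 2) ⟨by simp, hne, Or.inl ⟨?_, ?_, Or.inl ?_⟩⟩
        · rw [hT]
          exact ⟨rfl, u, Sym2.eq_swap, Or.inr ⟨huv, by simp⟩⟩
        · rintro ⟨⟨f, c⟩, hb, hbT⟩
          rw [hT] at hbT
          obtain ⟨hf, j, hej, h⟩ := hbT
          have hej : s(v, u) = s(v, j) := Sym2.eq_swap.trans hej
          have hj : u = j := by simpa [huv.ne, huv.ne'] using hej
          subst hj
          simp only at hf h
          subst hf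
          have hc : c = 2 := by simpa [huv, huv.not_gt] using h
          subst hc
          exact hne hb
        · rw [hT]
          exact ⟨rfl, u, Sym2.eq_swap, Or.inr ⟨huv, by simp⟩⟩
      rw [h1] at h2
      simp at h2
    rw [Set.ncard_eq_toFinset_card'] at hk
    obtain ⟨s, hs, hc⟩ := Finset.exists_subset_card_eq hk
    refine ⟨s, hc, fun u hu v hv hadj => ?_⟩
    have hu' : StrongStable T M u := by simpa using hs hu
    have hv' : StrongStable T M v := by simpa using hs hv
    rcases lt_trichotomy u v with h | h | h
    · exact main u v h hadj hu' hv'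
    · exact hadj.ne h
    · exact main v u h hadj.symm hv' hu'
end

section
/- Let G = (V ∪ U, E) be a bipartite graph with |V| = |U| = n_V and let k ≤ n_V. Construct the following 2-layer instance: the agents are a vertex agent a_v for each v ∈ V ∪ U, penalizing agents p_1,…,p_{n_V−k}, and two special agents b and c. In both layers, a_v and a_{v'} approve each other if and only if {v,v'} ∈ E; in both layers, each penalizing agent approves all agents in {a_v : v ∈ V} and approves b; in both layers, c approves b; agent b approves c in layer 1 only, and approves all penalizing agents in layer 2 only; there are no other approvals. Then G has a maximal matching with at most k edges if and only if the constructed instance admits an all-layers weakly stable matching. -/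
variable {A : Type*}

theorem matched_card {V U : Type*} [Fintype V] [Fintype U]
    (N : (V ⊕ U) → Option (V ⊕ U)) (hN : IsMatching N)
    (hb : ∀ x y : V ⊕ U, N x = some y → x.isLeft ≠ y.isLeft) :
    Set.ncard {x : V ⊕ U | (N x).isSome} = 2 * Set.ncard {v : V | (N (Sum.inl v)).isSome} := by
  have hset : {x : V ⊕ U | (N x).isSome} =
      Sum.inl '' {v : V | (N (Sum.inl v)).isSome} ∪ Sum.inr '' {u : U | (N (Sum.inr u)).isSome} := by
    ext x
    rcases x with v | u <;> simp
  have hL : ∀ v : V, (N (Sum.inl v)).isSome → ∃ u : U, N (Sum.inl v) = some (Sum.inr u) := by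
    intro v hv
    obtain ⟨y, hy⟩ := Option.isSome_iff_exists.1 hv
    rcases y with w | u
    · exact (hb _ _ hy rfl).elim
    · exact ⟨u, hy⟩
  have hR : ∀ u : U, (N (Sum.inr u)).isSome → ∃ v : V, N (Sum.inr u) = some (Sum.inl v) := by
    intro v hv
    obtain ⟨y, hy⟩ := Option.isSome_iff_exists.1 hv
    rcases y with w | u
    · exact ⟨w, hy⟩
    · exact (hb _ _ hy rfl).elim
  have hc : Set.ncard {v : V | (N (Sum.inl v)).isSome} =
      Set.ncard {u : U | (N (Sum.inr u)).isSome} := by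
    choose f hf using hL
    refine Set.ncard_congr f ?_ ?_ ?_
    · intro v hv
      have := hN.1 _ _ (hf v hv)
      simp [this]
    · intro v w hv hw he
      have h1 := hN.1 _ _ (hf v hv)
      have h2 := hN.1 _ _ (hf w hw)
      rw [he, h2] at h1
      simpa using h1.symm
    · intro u hu
      obtain ⟨v, hv⟩ := hR u hu
      have h1 := hN.1 _ _ hv
      have h2 : (N (Sum.inl v)).isSome := by simp [h1]
      refine ⟨v, h2, ?_⟩
      have h3 := hf v h2
      rw [h1] at h3
      simpa using h3.symm
  rw [hset, Set.ncard_union_eq, Set.ncard_image_of_injective _ Sum.inl_injective,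
    Set.ncard_image_of_injective _ Sum.inr_injective, ← hc, two_mul]
  rw [Set.disjoint_left]
  rintro _ ⟨v, _, rfl⟩ ⟨u, _, h⟩
  cases h

theorem minMaximalMatching_iff_allLayersWeak {V U : Type*}
    [Fintype V] [Fintype U] [DecidableEq V] [DecidableEq U]
    (G : SimpleGraph (V ⊕ U)) (nV k : ℕ)
    (hV : Fintype.card V = nV) (hU : Fintype.card U = nV) (hk : k ≤ nV)
    (hbip : ∀ x y : V ⊕ U, G.Adj x y → x.isLeft ≠ y.isLeft)
    (T : ((V ⊕ U) ⊕ Fin (nV - k)) ⊕ Bool → Fin 2 →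
      Set (((V ⊕ U) ⊕ Fin (nV - k)) ⊕ Bool))
    (hT : ∀ (x y : ((V ⊕ U) ⊕ Fin (nV - k)) ⊕ Bool) (i : Fin 2), y ∈ T x i ↔
      ((∃ v w : V ⊕ U, x = Sum.inl (Sum.inl v) ∧ y = Sum.inl (Sum.inl w) ∧ G.Adj v w) ∨
       (∃ (p : Fin (nV - k)) (v : V),
          x = Sum.inl (Sum.inr p) ∧ y = Sum.inl (Sum.inl (Sum.inl v))) ∨
       (∃ p : Fin (nV - k), x = Sum.inl (Sum.inr p) ∧ y = Sum.inr true) ∨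
       (x = Sum.inr false ∧ y = Sum.inr true) ∨
       (x = Sum.inr true ∧ y = Sum.inr false ∧ i = 0) ∨
       (∃ p : Fin (nV - k), x = Sum.inr true ∧ y = Sum.inl (Sum.inr p) ∧ i = 1))) :
    (∃ N : (V ⊕ U) → Option (V ⊕ U), IsMatching N ∧
      (∀ x y : V ⊕ U, N x = some y → G.Adj x y) ∧
      (∀ x y : V ⊕ U, G.Adj x y → (N x).isSome ∨ (N y).isSome) ∧
      Set.ncard {x : V ⊕ U | (N x).isSome} ≤ 2 * k) ↔
    (∃ M : (((V ⊕ U) ⊕ Fin (nV - k)) ⊕ Bool) → Option ((((V ⊕ U) ⊕ Fin (nV - k)) ⊕ Bool)),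
      IsMatching M ∧ ∀ i : Fin 2, WeakStable T M i) := by
  classical
  constructor
  · rintro ⟨N, hN, hNG, hmax, hcard⟩
    rw [matched_card N hN (fun x y h => hbip x y (hNG x y h))] at hcard
    have hcomp := Set.ncard_add_ncard_compl {v : V | (N (Sum.inl v)).isSome}
    rw [Nat.card_eq_fintype_card, hV] at hcomp
    have hle : Fintype.card (Fin (nV - k)) ≤
        Fintype.card ↥({v : V | (N (Sum.inl v)).isSome}ᶜ) := by
      rw [Fintype.card_fin, ← Nat.card_eq_fintype_card, Nat.card_coe_set_eq]
      omega
    obtain ⟨e⟩ := Function.Embedding.nonempty_of_card_le hle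
    obtain ⟨f, hfi, hfN⟩ : ∃ f : Fin (nV - k) → V, Function.Injective f ∧
        ∀ p, N (Sum.inl (f p)) = none := by
      refine ⟨fun p => (e p).1, fun p q h => e.injective (Subtype.ext h), fun p => ?_⟩
      have h : ¬ (N (Sum.inl (e p).1)).isSome = true := (e p).2
      simpa using h
    let M : (((V ⊕ U) ⊕ Fin (nV - k)) ⊕ Bool) → Option ((((V ⊕ U) ⊕ Fin (nV - k)) ⊕ Bool)) :=
      fun a => match a with
      | Sum.inl (Sum.inl x) =>
        match N x with
        | some y => some (Sum.inl (Sum.inl y))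
        | none => if h : ∃ p, x = Sum.inl (f p) then some (Sum.inl (Sum.inr h.choose)) else none
      | Sum.inl (Sum.inr p) => some (Sum.inl (Sum.inl (Sum.inl (f p))))
      | Sum.inr b => some (Sum.inr (!b))
    have M1 : ∀ x y, N x = some y → M (Sum.inl (Sum.inl x)) = some (Sum.inl (Sum.inl y)) := by
      intro x y h
      simp [M, h]
    have M2 : ∀ p, M (Sum.inl (Sum.inl (Sum.inl (f p)))) = some (Sum.inl (Sum.inr p)) := by
      intro p
      have h : ∃ q, (Sum.inl (f p) : V ⊕ U) = Sum.inl (f q) := ⟨p, rfl⟩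
      have h2 : h.choose = p := (hfi (Sum.inl_injective h.choose_spec)).symm
      simp only [M, hfN p]
      rw [dif_pos h, h2]
    have M3 : ∀ x, N x = none → (¬ ∃ p, x = Sum.inl (f p)) → M (Sum.inl (Sum.inl x)) = none := by
      intro x h h2
      simp only [M, h]
      rw [dif_neg h2]
    have M4 : ∀ p, M (Sum.inl (Sum.inr p)) = some (Sum.inl (Sum.inl (Sum.inl (f p)))) :=
      fun p => rfl
    have M5 : ∀ b, M (Sum.inr b) = some (Sum.inr (!b)) := fun b => rfl
    clear_value M
    have hsym : ∀ a b, M a = some b → M b = some a ∧ a ≠ b := by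
      rintro ((x | p) | c) b h
      · rcases hx : N x with _ | y
        · by_cases h2 : ∃ p, x = Sum.inl (f p)
          · obtain ⟨p, rfl⟩ := h2
            rw [M2] at h
            cases h
            exact ⟨M4 p, by simp⟩
          · rw [M3 x hx h2] at h
            cases h
        · rw [M1 x y hx] at h
          cases h
          refine ⟨M1 _ _ (hN.1 _ _ hx), ?_⟩
          rintro h
          cases h
          exact hN.2 _ hx
      · rw [M4] at h
        cases h
        exact ⟨M2 p, by simp⟩
      · rw [M5] at h
        cases h
        exact ⟨by rw [M5]; simp, by simp⟩
    refine ⟨M, ⟨fun a b h => (hsym a b h).1, fun a h => (hsym a a h).2 rfl⟩, ?_⟩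
    have hP : ∀ i p, Happy T M i (Sum.inl (Sum.inr p)) := by
      intro i p
      exact ⟨_, M4 p, (hT _ _ _).2 (Or.inr (Or.inl ⟨p, f p, rfl, rfl⟩))⟩
    have hC : ∀ i, Happy T M i (Sum.inr false) := by
      intro i
      exact ⟨_, M5 false, (hT _ _ _).2 (by simp)⟩
    have hX : ∀ i x, (N x).isSome → Happy T M i (Sum.inl (Sum.inl x)) := by
      intro i x hx
      obtain ⟨y, hy⟩ := Option.isSome_iff_exists.1 hx
      exact ⟨_, M1 x y hy, (hT _ _ _).2 (Or.inl ⟨x, y, rfl, rfl, hNG x y hy⟩)⟩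
    rintro i a a' ⟨-, -, h1, h2, h3, h4⟩
    rw [hT] at h1
    rcases h1 with ⟨v, w, rfl, rfl, hvw⟩ | ⟨p, v, rfl, rfl⟩ | ⟨p, rfl, rfl⟩ | ⟨rfl, rfl⟩ |
      ⟨rfl, rfl, rfl⟩ | ⟨p, rfl, rfl, rfl⟩
    · rcases hmax v w hvw with h | h
      · exact h3 (hX _ _ h)
      · exact h4 (hX _ _ h)
    · exact h3 (hP _ _)
    · exact h3 (hP _ _)
    · exact h3 (hC _)
    · exact h4 (hC _)
    · exact h4 (hP _ _)
  · rintro ⟨M, hM, hst⟩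
    have hbc : M (Sum.inr true) = some (Sum.inr false) := by
      by_contra hne
      refine hst 0 (Sum.inr true) (Sum.inr false) ⟨by simp, hne, (hT _ _ _).2 (by simp),
        (hT _ _ _).2 (by simp), ?_, ?_⟩
      · rintro ⟨y, hy, hyT⟩
        rw [hT] at hyT
        simp at hyT
        subst hyT
        exact hne hy
      · rintro ⟨y, hy, hyT⟩
        rw [hT] at hyT
        simp at hyT
        subst hyT
        exact hne (hM.1 _ _ hy)
    have hp : ∀ p : Fin (nV - k), ∃ v : V,
        M (Sum.inl (Sum.inr p)) = some (Sum.inl (Sum.inl (Sum.inl v))) := by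
      intro p
      have hbp : M (Sum.inr true) ≠ some (Sum.inl (Sum.inr p)) := by
        rw [hbc]; simp
      by_contra hne
      refine hst 1 (Sum.inr true) (Sum.inl (Sum.inr p)) ⟨by simp, hbp, (hT _ _ _).2 (by simp),
        (hT _ _ _).2 (by simp), ?_, ?_⟩
      · rintro ⟨y, hy, hyT⟩
        rw [hbc] at hy
        cases hy
        rw [hT] at hyT
        simp at hyT
      · rintro ⟨y, hy, hyT⟩
        rw [hT] at hyT
        simp at hyT
        rcases hyT with ⟨v, rfl⟩ | rfl
        · exact hne ⟨v, hy⟩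
        · exact hbp (hM.1 _ _ hy)
    choose f hf using hp
    have hfi : Function.Injective f := by
      intro p q h
      have h1 := hM.1 _ _ (hf p)
      have h2 := hM.1 _ _ (hf q)
      rw [h, h2] at h1
      simpa using h1.symm
    obtain ⟨N, hN⟩ : ∃ N : (V ⊕ U) → Option (V ⊕ U), ∀ x y, N x = some y ↔
        (M (Sum.inl (Sum.inl x)) = some (Sum.inl (Sum.inl y)) ∧ G.Adj x y) := by
      refine ⟨fun x => if h : ∃ y, M (Sum.inl (Sum.inl x)) = some (Sum.inl (Sum.inl y)) ∧
        G.Adj x y then some h.choose else none, fun x y => ?_⟩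
      by_cases h : ∃ y, M (Sum.inl (Sum.inl x)) = some (Sum.inl (Sum.inl y)) ∧ G.Adj x y
      · have hs := h.choose_spec
        simp only [dif_pos h]
        constructor
        · intro he
          cases he
          exact hs
        · intro he
          have h3 := he.1.symm.trans hs.1
          simpa using h3.symm
      · simp only [dif_neg h]
        constructor
        · intro he
          cases he
        · intro he
          exact absurd ⟨y, he⟩ h
    have hNm : IsMatching N := by
      refine ⟨fun a b h => ?_, fun a h => ?_⟩
      · rw [hN] at h ⊢
        exact ⟨hM.1 _ _ h.1, h.2.symm⟩
      · rw [hN] at h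
        exact G.loopless.irrefl a h.2
    have hNG : ∀ x y : V ⊕ U, N x = some y → G.Adj x y := fun x y h => ((hN x y).1 h).2
    have hH : ∀ x, Happy T M 0 (Sum.inl (Sum.inl x)) → (N x).isSome := by
      rintro x ⟨y, hy, hyT⟩
      rw [hT] at hyT
      obtain ⟨w, rfl, hw⟩ : ∃ w, y = Sum.inl (Sum.inl w) ∧ G.Adj x w := by
        rcases hyT with ⟨v, w, hv, rfl, hw⟩ | h
        · cases hv
          exact ⟨w, rfl, hw⟩
        · simp at h
      rw [(hN x w).2 ⟨hy, hw⟩]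
      rfl
    refine ⟨N, hNm, hNG, ?_, ?_⟩
    · intro x y hxy
      by_contra hne
      push Not at hne
      refine hst 0 (Sum.inl (Sum.inl x)) (Sum.inl (Sum.inl y)) ⟨?_, ?_, (hT _ _ _).2 ?_,
        (hT _ _ _).2 ?_, fun h => hne.1 (hH _ h), fun h => hne.2 (hH _ h)⟩
      · intro h
        cases h
        exact G.loopless.irrefl _ hxy
      · intro h
        apply hne.1
        rw [(hN x y).2 ⟨h, hxy⟩]
        rfl
      · exact Or.inl ⟨x, y, rfl, rfl, hxy⟩
      · exact Or.inl ⟨y, x, rfl, rfl, hxy.symm⟩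
    · rw [matched_card N hNm (fun x y h => hbip x y (hNG x y h))]
      have hcomp := Set.ncard_add_ncard_compl {v : V | (N (Sum.inl v)).isSome}
      rw [Nat.card_eq_fintype_card, hV] at hcomp
      have hsub : Set.range f ⊆ {v : V | (N (Sum.inl v)).isSome}ᶜ := by
        rintro _ ⟨p, rfl⟩ h
        obtain ⟨y, hy⟩ := Option.isSome_iff_exists.1 h
        have h1 := ((hN _ _).1 hy).1
        rw [hM.1 _ _ (hf p)] at h1
        simp at h1
      have h1 := Set.ncard_le_ncard hsub (Set.toFinite _)
      rw [← Set.image_univ, Set.ncard_image_of_injective _ hfi, Set.ncard_univ,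
        Nat.card_eq_fintype_card, Fintype.card_fin] at h1
      omega
end
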